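/- Let d ≥ 1, r ≥ d+1, 1 ≤ m ≤ r, and m ≤ k ≤ min{m+d, r} be integers. Let V be a finite set with |V| ≥ max{m+d, r}. Let X be a d-Leray simplicial complex on V, and M a matroid of rank r on V with rank function ρ. Assume that for every set U = {u₁,…,u_{d+1}, v₁,…,v_{m−1}} ⊆ V of d+m distinct elements with ρ(U) ≥ k, either {u₁,…,u_{d+1}} ∈ X or there exists j ∈ [m−1] such that σ ∪ {v_j} ∈ X for every proper subset σ of {u₁,…,u_{d+1}}. Then there is a face τ ∈ X such that ρ(V \ τ) ≤ k − 1. -/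

import Mathlib

/-- `Ind` is (the independence predicate of) a matroid. -/
structure IsMatroid {V : Type*} [DecidableEq V] (Ind : Finset V → Prop) : Prop where
  empty : Ind ∅
  subset : ∀ ⦃σ τ : Finset V⦄, Ind τ → σ ⊆ τ → Ind σ
  exchange : ∀ ⦃A B : Finset V⦄, Ind A → Ind B → A.card < B.card →
    ∃ x ∈ B, x ∉ A ∧ Ind (insert x A)

/-- The rank of `W`: the maximal size of an independent subset of `W`. -/
def matRank {V : Type*} [DecidableEq V] (Ind : Finset V → Prop) [DecidablePred Ind]
    (W : Finset V) : ℕ :=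
  (W.powerset.filter Ind).sup Finset.card

variable {V : Type*} [DecidableEq V] [LinearOrder V]

/-- Chains with `ℤ` coefficients: formal sums of faces of `K` of cardinality `n`
(so `n = 0` corresponds to the empty face, giving the *reduced* chain complex). -/
abbrev Chains (K : Finset V → Prop) (n : ℕ) : Type _ :=
  {σ : Finset V // K σ ∧ σ.card = n} →₀ ℤ

/-- The simplicial boundary map. -/
noncomputable def bd (K : Finset V → Prop) [DecidablePred K] (n : ℕ) :
    Chains K (n + 1) →ₗ[ℤ] Chains K n :=
  Finsupp.lsum ℤ fun σ : {σ : Finset V // K σ ∧ σ.card = n + 1} =>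
    LinearMap.toSpanSingleton ℤ (Chains K n)
      (∑ v ∈ σ.1.attach,
        if h : K (σ.1.erase v.1) then
          ((-1 : ℤ) ^ ((σ.1.filter (fun w => w < v.1)).card)) •
            Finsupp.single (⟨σ.1.erase v.1, h, by
              rw [Finset.card_erase_of_mem v.2, σ.2.2]; omega⟩ :
              {τ : Finset V // K τ ∧ τ.card = n}) (1 : ℤ)
        else 0)

/-- Cycles: kernel of the boundary map (everything in the bottom degree). -/
noncomputable def cycles (K : Finset V → Prop) [DecidablePred K] :
    (n : ℕ) → Submodule ℤ (Chains K n)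
  | 0 => ⊤
  | (m + 1) => LinearMap.ker (bd K m)

/-- Reduced homology: `RHom K n` is the reduced simplicial homology of `K`
in dimension `n - 1` (so `RHom K (i+1)` is `H̃ᵢ(K)`). -/
noncomputable abbrev RHom (K : Finset V → Prop) [DecidablePred K] (n : ℕ) : Type _ :=
  (cycles K n) ⧸ (Submodule.comap (cycles K n).subtype (LinearMap.range (bd K n)))

/-- A complex is `d`-Leray if every induced subcomplex has trivial reduced homology
in dimensions `d` and higher. -/
def IsDLeray (d : ℕ) (K : Finset V → Prop) [DecidablePred K] : Prop :=
  ∀ (W : Finset V) (i : ℕ), d ≤ i →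
    Subsingleton (RHom (fun σ => K σ ∧ σ ⊆ W) (i + 1))


/-! ### Chains as functions on all finite sets -/

section Ops
variable {V : Type*} [DecidableEq V] [LinearOrder V]

/-- sign of `v` relative to `τ` -/
def sg (v : V) (τ : Finset V) : ℤ := (-1) ^ ((τ.filter (fun w => w < v)).card)

lemma sg_insert {x : V} (v : V) {τ : Finset V} (hx : x ∉ τ) :
    sg v (insert x τ) = if x < v then - sg v τ else sg v τ := by
  unfold sg
  rw [Finset.filter_insert]
  split_ifs with h
  · rw [Finset.card_insert_of_notMem (by simp [hx]), pow_succ]; ring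
  · rfl

lemma sg_insert_self (v : V) (τ : Finset V) : sg v (insert v τ) = sg v τ := by
  by_cases h : v ∈ τ
  · rw [Finset.insert_eq_of_mem h]
  · rw [sg_insert v h, if_neg (lt_irrefl v)]

lemma sg_erase_self (v : V) (τ : Finset V) : sg v (τ.erase v) = sg v τ := by
  by_cases h : v ∈ τ
  · conv_rhs => rw [← Finset.insert_erase h]
    rw [sg_insert_self]
  · rw [Finset.erase_eq_of_notMem h]

lemma sg_mul_self (v : V) (τ : Finset V) : sg v τ * sg v τ = 1 := by
  unfold sg; rw [← mul_pow]; simp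

lemma sg_ne_zero (v : V) (τ : Finset V) : sg v τ ≠ 0 := by
  intro h; have := sg_mul_self v τ; rw [h] at this; simp at this

lemma sg_anti {e f : V} (hef : e ≠ f) {τ : Finset V} (he : e ∉ τ) (hf : f ∉ τ) :
    sg e τ * sg f (insert e τ) = - (sg f τ * sg e (insert f τ)) := by
  rw [sg_insert f he, sg_insert e hf]
  rcases lt_or_gt_of_ne hef with h | h
  · rw [if_pos h, if_neg (not_lt.mpr h.le)]; ring
  · rw [if_neg (not_lt.mpr h.le), if_pos h]; ring

/-- contraction by `e` -/
def io (e : V) : (Finset V → ℤ) →ₗ[ℤ] (Finset V → ℤ) where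
  toFun c := fun τ => if e ∈ τ then 0 else sg e τ * c (insert e τ)
  map_add' a b := by ext τ; simp only [Pi.add_apply]; split_ifs <;> ring
  map_smul' a b := by ext τ; simp only [Pi.smul_apply, smul_eq_mul, RingHom.id_apply]; split_ifs <;> ring

/-- exterior multiplication by `e` -/
def we (e : V) : (Finset V → ℤ) →ₗ[ℤ] (Finset V → ℤ) where
  toFun c := fun τ => if e ∈ τ then sg e τ * c (τ.erase e) else 0
  map_add' a b := by ext τ; simp only [Pi.add_apply]; split_ifs <;> ring
  map_smul' a b := by ext τ; simp only [Pi.smul_apply, smul_eq_mul, RingHom.id_apply]; split_ifs <;> ring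

lemma io_apply (e : V) (c : Finset V → ℤ) (τ : Finset V) :
    io e c τ = if e ∈ τ then 0 else sg e τ * c (insert e τ) := rfl

lemma we_apply (e : V) (c : Finset V → ℤ) (τ : Finset V) :
    we e c τ = if e ∈ τ then sg e τ * c (τ.erase e) else 0 := rfl

lemma io_io (e f : V) (c : Finset V → ℤ) : io e (io f c) = - io f (io e c) := by
  ext τ
  simp only [io_apply, Pi.neg_apply, Finset.mem_insert]
  by_cases hef : e = f
  · subst hef; simp
  · by_cases he : e ∈ τ <;> by_cases hf : f ∈ τ <;> simp [he, hf, hef, Ne.symm hef]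
    have := sg_anti hef he hf
    rw [Finset.insert_comm f e, ← mul_assoc, ← mul_assoc, this]; ring

lemma io_we_self (e : V) (c : Finset V → ℤ) : io e (we e c) + we e (io e c) = c := by
  ext τ
  simp only [io_apply, we_apply, Pi.add_apply]
  by_cases he : e ∈ τ
  · simp only [he, if_true, Finset.notMem_erase, if_false, Finset.insert_erase he, sg_erase_self]
    rw [← mul_assoc, sg_mul_self]; ring
  · simp only [he, if_false, Finset.mem_insert_self, if_true, Finset.erase_insert he, sg_insert_self]
    rw [← mul_assoc, sg_mul_self]; ring

lemma io_we {e f : V} (hef : e ≠ f) (c : Finset V → ℤ) : io f (we e c) = - we e (io f c) := by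
  ext τ
  simp only [io_apply, we_apply, Pi.neg_apply]
  by_cases he : e ∈ τ <;> by_cases hf : f ∈ τ <;>
    simp [he, hf, hef, Ne.symm hef]
  obtain ⟨σ, hσ, rfl⟩ : ∃ σ, e ∉ σ ∧ insert e σ = τ :=
    ⟨τ.erase e, by simp, Finset.insert_erase he⟩
  have hfσ : f ∉ σ := fun h => hf (by simp [h])
  have h1 := sg_anti hef hσ hfσ
  have : (insert f (insert e σ)).erase e = insert f σ := by
    rw [Finset.insert_comm, Finset.erase_insert]; simp [hσ, hef]
  rw [this, Finset.erase_insert hσ, Finset.insert_comm f e, sg_insert_self, sg_insert_self]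
  have h2 := sg_mul_self e σ
  have h3 := sg_mul_self f σ
  have e1 : sg f (insert e σ) * sg e (insert f σ) = - (sg e σ * sg f σ) := by
    rw [sg_insert f hσ, sg_insert e hfσ]
    rcases lt_or_gt_of_ne hef with h | h
    · rw [if_pos h, if_neg (not_lt.mpr h.le)]; ring
    · rw [if_neg (not_lt.mpr h.le), if_pos h]; ring
  rw [← mul_assoc, ← mul_assoc, e1]; ring

variable [Fintype V]

/-- boundary -/
def dd : (Finset V → ℤ) →ₗ[ℤ] (Finset V → ℤ) := ∑ e : V, io e

lemma dd_eq (c : Finset V → ℤ) : dd c = ∑ e : V, io e c := by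
  simp [dd, LinearMap.sum_apply]

lemma io_dd (e : V) (c : Finset V → ℤ) : io e (dd c) = - dd (io e c) := by
  rw [dd_eq, dd_eq, map_sum, ← Finset.sum_neg_distrib]
  exact Finset.sum_congr rfl fun f _ => io_io e f c

lemma dd_dd (c : Finset V → ℤ) : dd (dd c) = 0 := by
  have h : dd (dd c) = - dd (dd c) := by
    conv_lhs => rw [dd_eq (dd c)]
    simp only [io_dd]
    rw [Finset.sum_neg_distrib, ← map_sum, ← dd_eq]
  ext τ
  have := congrFun h τ
  simp only [Pi.neg_apply, Pi.zero_apply] at this ⊢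
  omega

lemma dd_we (e : V) (c : Finset V → ℤ) : dd (we e c) + we e (dd c) = c := by
  rw [dd_eq, dd_eq, map_sum, ← Finset.sum_add_distrib, Finset.sum_eq_single e]
  · exact io_we_self e c
  · intro f _ hf
    rw [io_we hf.symm]; simp
  · simp

lemma dd_apply (c : Finset V → ℤ) (τ : Finset V) :
    dd c τ = ∑ v ∈ Finset.univ \ τ, sg v τ * c (insert v τ) := by
  rw [dd_eq, Finset.sum_apply]
  simp only [io_apply]
  rw [← Finset.sum_subset (Finset.subset_univ (Finset.univ \ τ))]
  · apply Finset.sum_congr rfl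
    intro v hv; simp at hv; simp [hv]
  · intro v _ hv; simp at hv; simp [hv]

lemma io_single (e : V) (σ : Finset V) :
    io e (Pi.single σ 1) = if e ∈ σ then sg e σ • Pi.single (σ.erase e) 1 else 0 := by
  ext τ
  simp only [io_apply, Pi.single_apply]
  by_cases he : e ∈ σ
  · rw [if_pos he]
    simp only [Pi.smul_apply, Pi.single_apply, smul_eq_mul]
    by_cases h : τ = σ.erase e
    · subst h; simp [Finset.insert_erase he, sg_erase_self]
    · by_cases h1 : e ∈ τ
      · simp [h1, h]
      · have : insert e τ ≠ σ := by rintro rfl; exact h (Finset.erase_insert h1).symm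
        simp [h1, h, this]
  · rw [if_neg he]
    have : insert e τ ≠ σ := by rintro rfl; simp at he
    simp [this]

lemma dd_single (σ : Finset V) :
    dd (Pi.single σ 1) = ∑ v ∈ σ, sg v σ • Pi.single (σ.erase v) (1:ℤ) := by
  rw [dd_eq]
  simp only [io_single]
  rw [← Finset.sum_filter]
  simp

lemma dd_card {c : Finset V → ℤ} {s : ℕ} (hc : ∀ A, c A ≠ 0 → A.card = s) :
    ∀ A, dd c A ≠ 0 → A.card + 1 = s := by
  intro A hA
  rw [dd_apply] at hA
  obtain ⟨v, hv, h⟩ := Finset.exists_ne_zero_of_sum_ne_zero hA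
  have := hc _ (right_ne_zero_of_mul h)
  simp at hv
  rw [Finset.card_insert_of_notMem hv] at this
  exact this

end Ops

section Bridge
variable {V : Type*} [DecidableEq V] [LinearOrder V] [Fintype V]

/-- extension by zero -/
noncomputable def extL (L : Finset V → Prop) (n : ℕ) : Chains L n →ₗ[ℤ] (Finset V → ℤ) :=
  Finsupp.linearCombination ℤ (fun σ => Pi.single σ.1 1)

lemma extL_single (L : Finset V → Prop) (n : ℕ) (σ) :
    extL L n (Finsupp.single σ 1) = Pi.single σ.1 1 := by
  simp [extL]

lemma extL_apply (L : Finset V → Prop) (n : ℕ) (u : Chains L n) (A : Finset V)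
    (h : L A ∧ A.card = n) : extL L n u A = u ⟨A, h⟩ := by
  induction u using Finsupp.induction_linear with
  | zero => simp
  | add f g hf hg => simp [hf, hg]
  | single a b =>
    have : Finsupp.single a b = b • Finsupp.single a (1:ℤ) := by simp
    rw [this, map_smul, extL_single]
    simp only [Pi.smul_apply, Pi.single_apply, Finsupp.smul_apply, Finsupp.single_apply]
    congr 1
    by_cases hA : A = a.1
    · subst hA; simp
    · rw [if_neg hA, if_neg]; rintro rfl; exact hA rfl

lemma extL_apply_not (L : Finset V → Prop) (n : ℕ) (u : Chains L n) (A : Finset V)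
    (h : ¬ (L A ∧ A.card = n)) : extL L n u A = 0 := by
  induction u using Finsupp.induction_linear with
  | zero => simp
  | add f g hf hg => simp [hf, hg]
  | single a b =>
    have : Finsupp.single a b = b • Finsupp.single a (1:ℤ) := by simp
    rw [this, map_smul, extL_single]
    simp only [Pi.smul_apply, Pi.single_apply]
    rw [if_neg]; · simp
    rintro rfl; exact h a.2

lemma extL_inj (L : Finset V → Prop) (n : ℕ) (u : Chains L n) (h : extL L n u = 0) : u = 0 := by
  ext ⟨A, hA⟩
  rw [← extL_apply L n u A hA, h]; rfl

lemma extL_surj (L : Finset V → Prop) (n : ℕ) (z : Finset V → ℤ)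
    (hz : ∀ A, z A ≠ 0 → L A ∧ A.card = n) : ∃ u, extL L n u = z := by
  classical
  refine ⟨Finsupp.equivFunOnFinite.symm (fun σ => z σ.1), ?_⟩
  ext A
  by_cases h : L A ∧ A.card = n
  · rw [extL_apply _ _ _ _ h]; simp
  · rw [extL_apply_not _ _ _ _ h]; by_contra h2; exact h (hz A (Ne.symm h2))

lemma dd_extL (L : Finset V → Prop) [DecidablePred L]
    (hL : ∀ ⦃σ τ : Finset V⦄, L τ → σ ⊆ τ → L σ) (n : ℕ) (u : Chains L (n+1)) :
    dd (extL L (n+1) u) = extL L n (bd L n u) := by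
  have : dd ∘ₗ (extL L (n+1)) = extL L n ∘ₗ bd L n := by
    apply Finsupp.lhom_ext'
    intro σ
    ext1
    simp only [LinearMap.comp_apply, Finsupp.lsingle_apply, extL_single, dd_single]
    simp only [bd, Finsupp.lsum_single, LinearMap.toSpanSingleton_apply, one_smul, map_sum]
    rw [← Finset.sum_attach]
    apply Finset.sum_congr rfl
    intro v _
    rw [dif_pos (hL σ.2.1 (Finset.erase_subset _ _)), map_smul, extL_single]
    rfl
  exact LinearMap.congr_fun this u

lemma leray_fill {d : ℕ} {K : Finset V → Prop} [DecidablePred K]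
    (hcomplex : ∀ ⦃σ τ : Finset V⦄, K τ → σ ⊆ τ → K σ)
    (hLeray : IsDLeray d K) (W : Finset V) (s : ℕ) (hs : d + 1 ≤ s) (z : Finset V → ℤ)
    (hz : ∀ A, z A ≠ 0 → K A ∧ A ⊆ W ∧ A.card = s) (hdz : dd z = 0) :
    ∃ u : Finset V → ℤ, (∀ A, u A ≠ 0 → K A ∧ A ⊆ W ∧ A.card = s + 1) ∧ dd u = z := by
  obtain ⟨i, rfl⟩ : ∃ i, s = i + 1 := ⟨s - 1, by omega⟩
  have hL : ∀ ⦃σ τ : Finset V⦄, (K τ ∧ τ ⊆ W) → σ ⊆ τ → (K σ ∧ σ ⊆ W) :=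
    fun σ τ h1 h2 => ⟨hcomplex h1.1 h2, h2.trans h1.2⟩
  have hss := hLeray W i (by omega)
  obtain ⟨z', rfl⟩ := extL_surj (fun σ => K σ ∧ σ ⊆ W) (i+1) z
    (fun A hA => ⟨⟨(hz A hA).1, (hz A hA).2.1⟩, (hz A hA).2.2⟩)
  rw [dd_extL _ hL] at hdz
  have hz' : z' ∈ cycles (fun σ => K σ ∧ σ ⊆ W) (i+1) := by
    change z' ∈ LinearMap.ker _
    exact extL_inj _ _ _ hdz
  have hmem : (⟨z', hz'⟩ : cycles (fun σ => K σ ∧ σ ⊆ W) (i+1)) ∈ Submodule.comap (cycles (fun σ => K σ ∧ σ ⊆ W) (i+1)).subtype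
      (LinearMap.range (bd (fun σ => K σ ∧ σ ⊆ W) (i+1))) :=
    (Submodule.Quotient.mk_eq_zero _).mp (hss.elim _ _)
  obtain ⟨u, hu⟩ := hmem
  refine ⟨extL _ _ u, ?_, ?_⟩
  · intro A hA
    by_contra h
    apply hA
    apply extL_apply_not
    rintro ⟨⟨h1, h2⟩, h3⟩; exact h ⟨h1, h2, h3⟩
  · rw [dd_extL _ hL, hu]; rfl

end Bridge

section Mat
variable {V : Type*} [DecidableEq V] [LinearOrder V] [Fintype V]

lemma mat_fill : ∀ (n : ℕ) (Ind : Finset V → Prop), IsMatroid Ind → ∀ (W : Finset V),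
    W.card = n → ∀ (j : ℕ) (B : Finset V), B ⊆ W → Ind B → j < B.card →
    ∀ z : Finset V → ℤ, (∀ A, z A ≠ 0 → Ind A ∧ A ⊆ W ∧ A.card = j) → dd z = 0 →
    ∃ u : Finset V → ℤ, (∀ A, u A ≠ 0 → Ind A ∧ A ⊆ W ∧ A.card = j + 1) ∧ dd u = z := by
  intro n
  induction n with
  | zero =>
    intro Ind hM W hW j B hBW hB hj
    have := Finset.card_le_card hBW
    omega
  | succ n ih =>
    intro Ind hM W hW j B hBW hB hj z hz hdz
    obtain ⟨e, he⟩ : B.Nonempty := Finset.card_pos.mp (by omega)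
    have heW := hBW he
    have hWe : (W.erase e).card = n := by rw [Finset.card_erase_of_mem heW]; omega
    have cone : (∀ A, z A ≠ 0 → e ∉ A → Ind (insert e A)) →
        ∃ u : Finset V → ℤ, (∀ A, u A ≠ 0 → Ind A ∧ A ⊆ W ∧ A.card = j + 1) ∧ dd u = z := by
      intro hc
      refine ⟨we e z, ?_, ?_⟩
      · intro A hA
        rw [we_apply] at hA
        by_cases heA : e ∈ A
        · rw [if_pos heA] at hA
          have h0 := right_ne_zero_of_mul hA
          obtain ⟨h1, h2, h3⟩ := hz _ h0
          have h4 := hc _ h0 (by simp)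
          rw [Finset.insert_erase heA] at h4
          refine ⟨h4, ?_, ?_⟩
          · rw [← Finset.insert_erase heA]; exact Finset.insert_subset heW h2
          · rw [Finset.card_erase_of_mem heA] at h3
            have := Finset.card_pos.mpr ⟨e, heA⟩
            omega
        · simp [heA] at hA
      · have := dd_we e z
        rw [hdz, map_zero, add_zero] at this; exact this
    by_cases hcase : ∃ B' ⊆ W.erase e, Ind B' ∧ j < B'.card
    · rcases Nat.eq_zero_or_pos j with rfl | hjpos
      · apply cone
        intro A hA _
        have := (hz A hA).2.2
        rw [Finset.card_eq_zero] at this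
        subst this
        exact hM.subset hB (by simpa using he)
      obtain ⟨j, rfl⟩ : ∃ i, j = i + 1 := ⟨j - 1, by omega⟩
      obtain ⟨B', hB'W, hB', hjB'⟩ := hcase
      have hMe : IsMatroid (fun A => e ∉ A ∧ Ind (insert e A)) := by
        refine ⟨⟨by simp, hM.subset hB (by simpa using he)⟩, ?_, ?_⟩
        · rintro σ τ ⟨h1, h2⟩ h
          exact ⟨fun h3 => h1 (h h3), hM.subset h2 (Finset.insert_subset_insert _ h)⟩
        · rintro A C ⟨h1, h2⟩ ⟨h3, h4⟩ hlt
          obtain ⟨x, hx, hxA, hI⟩ := hM.exchange h2 h4 (by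
            rw [Finset.card_insert_of_notMem h1, Finset.card_insert_of_notMem h3]; omega)
          simp only [Finset.mem_insert, not_or] at hx hxA
          refine ⟨x, hx.resolve_left hxA.1, hxA.2, ?_, ?_⟩
          · simp only [Finset.mem_insert, not_or]; exact ⟨Ne.symm hxA.1, h1⟩
          · rw [Finset.insert_comm]; exact hI
      obtain ⟨u1, hu1, hdu1⟩ := ih _ hMe (W.erase e) hWe j (B.erase e)
        (Finset.erase_subset_erase _ hBW) ⟨by simp, by rwa [Finset.insert_erase he]⟩
        (by rw [Finset.card_erase_of_mem he]; omega) (io e z) (by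
          intro A hA
          rw [io_apply] at hA
          by_cases heA : e ∈ A
          · simp [heA] at hA
          · rw [if_neg heA] at hA
            obtain ⟨h1, h2, h3⟩ := hz _ (right_ne_zero_of_mul hA)
            rw [Finset.card_insert_of_notMem heA] at h3
            refine ⟨⟨heA, h1⟩, ?_, by omega⟩
            intro x hx
            rw [Finset.mem_erase]
            exact ⟨fun h => heA (h ▸ hx), h2 (Finset.mem_insert_of_mem hx)⟩) (by
          have := io_dd e z
          rw [hdz, map_zero] at this
          exact neg_eq_zero.mp this.symm)
      have key : z + dd (we e u1) = io e (we e z) + u1 := by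
        have h1 := dd_we e u1
        have h2 := io_we_self e z
        rw [hdu1] at h1
        calc z + dd (we e u1) = (io e (we e z) + we e (io e z)) + dd (we e u1) := by rw [h2]
          _ = io e (we e z) + (dd (we e u1) + we e (io e z)) := by abel
          _ = _ := by rw [h1]
      obtain ⟨u2, hu2, hdu2⟩ := ih Ind hM (W.erase e) hWe (j+1) B' hB'W hB' hjB'
        (z + dd (we e u1)) (by
          rw [key]
          intro A hA
          by_cases h : u1 A = 0
          · have h2 : io e (we e z) A ≠ 0 := by
              intro h3; apply hA; simp [h3, h]
            rw [io_apply] at h2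
            by_cases heA : e ∈ A
            · simp [heA] at h2
            · rw [if_neg heA] at h2
              have h3 := right_ne_zero_of_mul h2
              rw [we_apply, if_pos (by simp), Finset.erase_insert heA] at h3
              obtain ⟨h4, h5, h6⟩ := hz _ (right_ne_zero_of_mul h3)
              exact ⟨h4, fun x hx => Finset.mem_erase.mpr ⟨fun h => heA (h ▸ hx), h5 hx⟩, h6⟩
          · obtain ⟨⟨h1, h2⟩, h3, h4⟩ := hu1 A h
            exact ⟨hM.subset h2 (Finset.subset_insert _ _), h3, h4⟩) (by
          rw [map_add, hdz, dd_dd, add_zero])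
      refine ⟨u2 - we e u1, ?_, by rw [map_sub, hdu2]; abel⟩
      intro A hA
      by_cases h : u2 A = 0
      · have h2 : we e u1 A ≠ 0 := by
          intro h3; apply hA; simp [h3, h]
        rw [we_apply] at h2
        by_cases heA : e ∈ A
        · rw [if_pos heA] at h2
          obtain ⟨⟨h4, h5⟩, h6, h7⟩ := hu1 _ (right_ne_zero_of_mul h2)
          rw [Finset.insert_erase heA] at h5
          refine ⟨h5, ?_, ?_⟩
          · rw [← Finset.insert_erase heA]
            exact Finset.insert_subset heW (h6.trans (Finset.erase_subset _ _))
          · rw [Finset.card_erase_of_mem heA] at h7; omega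
        · simp [heA] at h2
      · obtain ⟨h1, h2, h3⟩ := hu2 A h
        exact ⟨h1, h2.trans (Finset.erase_subset _ _), h3⟩
    · push Not at hcase
      apply cone
      intro A hA heA
      obtain ⟨h1, h2, h3⟩ := hz A hA
      obtain ⟨x, hx, hxA, hI⟩ := hM.exchange h1 hB (by omega)
      by_cases hxe : x = e
      · rwa [← hxe]
      · exfalso
        have := hcase (insert x A) (by
          intro y hy
          rw [Finset.mem_erase]
          rcases Finset.mem_insert.mp hy with rfl | hy
          · exact ⟨hxe, hBW hx⟩
          · exact ⟨fun h => heA (h ▸ hy), h2 hy⟩) hI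
        rw [Finset.card_insert_of_notMem hxA] at this
        omega

variable {Ind : Finset V → Prop} [DecidablePred Ind]

lemma le_matRank {I W : Finset V} (hI : Ind I) (h : I ⊆ W) : I.card ≤ matRank Ind W :=
  Finset.le_sup (f := Finset.card) (by simp [hI, h])

lemma exists_matRank (hM : IsMatroid Ind) (W : Finset V) :
    ∃ I ⊆ W, Ind I ∧ I.card = matRank Ind W := by
  obtain ⟨I, hI, h⟩ := Finset.exists_mem_eq_sup (W.powerset.filter Ind)
    ⟨∅, by simp [hM.empty]⟩ Finset.card
  simp at hI
  exact ⟨I, hI.1, hI.2, h.symm⟩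

lemma exists_of_le_matRank (hM : IsMatroid Ind) {W : Finset V} {k : ℕ} (h : k ≤ matRank Ind W) :
    ∃ I ⊆ W, Ind I ∧ I.card = k := by
  obtain ⟨I, h1, h2, h3⟩ := exists_matRank hM W
  obtain ⟨J, hJ, hJc⟩ := Finset.exists_subset_card_eq (h3 ▸ h)
  exact ⟨J, hJ.trans h1, hM.subset h2 hJ, hJc⟩

lemma matRank_mono (hM : IsMatroid Ind) {A B : Finset V} (h : A ⊆ B) :
    matRank Ind A ≤ matRank Ind B := by
  obtain ⟨I, h1, h2, h3⟩ := exists_matRank hM A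
  rw [← h3]; exact le_matRank h2 (h1.trans h)

lemma matRank_le_add (hM : IsMatroid Ind) {A B : Finset V} (h : A ⊆ B) :
    matRank Ind B + A.card ≤ matRank Ind A + B.card := by
  obtain ⟨I, h1, h2, h3⟩ := exists_matRank hM B
  have h4 : (I ∩ A).card ≤ matRank Ind A :=
    le_matRank (hM.subset h2 Finset.inter_subset_left) Finset.inter_subset_right
  have h5 := Finset.card_inter_add_card_sdiff I A
  have h6 : (I \ A).card ≤ (B \ A).card := Finset.card_le_card (Finset.sdiff_subset_sdiff h1 le_rfl)
  have h7 := Finset.card_sdiff_add_card_eq_card h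
  omega

lemma matRank_exch (hM : IsMatroid Ind) {A B : Finset V} (h : matRank Ind A < matRank Ind B) :
    ∃ x ∈ B, x ∉ A ∧ matRank Ind A + 1 ≤ matRank Ind (insert x A) := by
  obtain ⟨I, h1, h2, h3⟩ := exists_matRank hM A
  obtain ⟨J, g1, g2, g3⟩ := exists_matRank hM B
  obtain ⟨x, hx, hxI, hI⟩ := hM.exchange h2 g2 (by omega)
  have hc := Finset.card_insert_of_notMem hxI
  refine ⟨x, g1 hx, ?_, ?_⟩
  · intro hxA
    have := le_matRank hI (Finset.insert_subset hxA h1)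
    omega
  · have := le_matRank hI (Finset.insert_subset_insert x h1)
    omega

/-- the elongation -/
lemma elong_isMatroid (hM : IsMatroid Ind) (D c : ℕ) :
    IsMatroid (fun A => A.card ≤ D ∧ A.card ≤ matRank Ind A + c) := by
  refine ⟨by simp, ?_, ?_⟩
  · rintro σ τ ⟨h1, h2⟩ h
    have := matRank_le_add hM h
    have := Finset.card_le_card h
    exact ⟨by omega, by omega⟩
  · rintro A B ⟨h1, h2⟩ ⟨h3, h4⟩ hlt
    by_cases h : A.card < matRank Ind A + c
    · obtain ⟨x, hx, hxA⟩ := Finset.exists_mem_notMem_of_card_lt_card hlt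
      refine ⟨x, hx, hxA, ?_, ?_⟩ <;> rw [Finset.card_insert_of_notMem hxA]
      · omega
      · have := matRank_mono hM (Finset.subset_insert x A)
        omega
    · obtain ⟨x, hx, hxA, hr⟩ := matRank_exch hM (A := A) (B := B) (by omega)
      refine ⟨x, hx, hxA, ?_, ?_⟩ <;> rw [Finset.card_insert_of_notMem hxA] <;> omega

lemma mat_extend' {Ind : Finset V → Prop} (hM : IsMatroid Ind) {A B : Finset V} (hA : Ind A) (hB : Ind B)
    (h : A.card ≤ B.card) : ∃ C, A ⊆ C ∧ C ⊆ A ∪ B ∧ Ind C ∧ C.card = B.card := by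
  obtain ⟨n, hn⟩ : ∃ n, n + A.card = B.card := ⟨B.card - A.card, by omega⟩
  induction n generalizing A with
  | zero => exact ⟨A, le_rfl, Finset.subset_union_left, hA, by omega⟩
  | succ n ih =>
    obtain ⟨x, hx, hxA, hI⟩ := hM.exchange hA hB (by omega)
    have hc := Finset.card_insert_of_notMem hxA
    obtain ⟨C, h1, h2, h3, h4⟩ := ih hI (by omega) (by omega)
    refine ⟨C, (Finset.subset_insert _ _).trans h1, ?_, h3, h4⟩
    intro y hy
    have := h2 hy
    simp only [Finset.mem_union, Finset.mem_insert] at this ⊢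
    rcases this with (rfl | h) | h
    · exact Or.inr hx
    · exact Or.inl h
    · exact Or.inr h

end Mat

section Main
variable {V : Type*} [DecidableEq V] [LinearOrder V] [Fintype V]

lemma conn {d : ℕ} {K : Finset V → Prop} [DecidablePred K]
    (hcomplex : ∀ ⦃σ τ : Finset V⦄, K τ → σ ⊆ τ → K σ)
    (hLeray : IsDLeray d K) {S : Finset V} (hS : ¬ K S) (hSc : S.card = d + 1) :
    ∀ (q : ℕ) (Q : Finset V), Q.card = q + 1 → Disjoint Q S →
      (∀ v ∈ Q, ∀ s ∈ S, K (insert v (S.erase s))) → ∀ s ∈ S, K (Q ∪ S.erase s) := by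
  intro q
  induction q with
  | zero =>
    intro Q hQ _ h s hs
    obtain ⟨v, rfl⟩ := Finset.card_eq_one.mp hQ
    exact h v (by simp) s hs
  | succ q ih =>
    intro Q hQ hdis h s hs
    set W := Q ∪ S with hW
    have hWc : W.card = q + 2 + (d + 1) := by
      rw [hW, Finset.card_union_of_disjoint hdis]; omega
    set D : Finset V → ℤ := dd (Pi.single W 1) with hD
    have hDne : ∀ A, D A ≠ 0 → ∃ v, v ∉ A ∧ insert v A = W := by
      intro A hA
      rw [hD, dd_apply] at hA
      obtain ⟨v, hv, h⟩ := Finset.exists_ne_zero_of_sum_ne_zero hA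
      have h2 := right_ne_zero_of_mul h
      rw [Pi.single_apply] at h2
      refine ⟨v, by simpa using hv, ?_⟩
      by_contra h3; simp [h3] at h2
    have hDs : D (W.erase s) ≠ 0 := by
      have hsW : s ∈ W := by simp [hW, hs]
      rw [hD, dd_apply, Finset.sum_eq_single s]
      · rw [Finset.insert_erase hsW]; simp [sg_ne_zero]
      · intro v hv hvs
        rw [Pi.single_apply, if_neg, mul_zero]
        intro h2
        have : s ∈ insert v (W.erase s) := by rw [h2]; exact hsW
        simp [Ne.symm hvs] at this
      · simp
    set w : Finset V → ℤ := fun A => if Q ⊆ A then D A else 0 with hw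
    have hDw : dd (D - w) = - dd w := by rw [map_sub, hD, dd_dd]; simp
    have hwA : ∀ A, w A ≠ 0 → Q ⊆ A ∧ D A ≠ 0 := by
      intro A hA
      by_cases hQA : Q ⊆ A
      · simpa [hw, hQA] using hA
      · simp [hw, hQA] at hA
    have hwA' : ∀ A, (D - w) A ≠ 0 → ¬ Q ⊆ A ∧ D A ≠ 0 := by
      intro A hA
      by_cases hQA : Q ⊆ A
      · simp [hw, hQA] at hA
      · simpa [hw, hQA] using hA
    have hz : ∀ A, dd w A ≠ 0 → K A ∧ A ⊆ W ∧ A.card = q + 1 + d := by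
      intro A hA
      have hA' : dd (D - w) A ≠ 0 := by rw [hDw]; simpa using hA
      rw [dd_apply] at hA hA'
      obtain ⟨v, hv, h1⟩ := Finset.exists_ne_zero_of_sum_ne_zero hA
      obtain ⟨h2, h3⟩ := hwA _ (right_ne_zero_of_mul h1)
      obtain ⟨t, ht, htW⟩ := hDne _ h3
      obtain ⟨v', hv', h1'⟩ := Finset.exists_ne_zero_of_sum_ne_zero hA'
      obtain ⟨h2', h3'⟩ := hwA' _ (right_ne_zero_of_mul h1')
      obtain ⟨a, ha, haW⟩ := hDne _ h3'
      have hAW : A ⊆ W := by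
        rw [← htW]; exact (Finset.subset_insert _ _).trans (Finset.subset_insert _ _)
      have htQ : t ∉ Q := fun h => ht (h2 h)
      have htS : t ∈ S := by
        have : t ∈ W := by rw [← htW]; simp
        rw [hW, Finset.mem_union] at this
        exact this.resolve_left htQ
      have haQ : a ∈ Q := by
        by_contra haQ
        apply h2'
        intro x hx
        have : x ∈ insert a (insert v' A) := by rw [haW, hW]; simp [hx]
        rcases Finset.mem_insert.mp this with rfl | h
        · exact absurd hx haQ
        · exact h
      refine ⟨?_, hAW, ?_⟩
      · refine hcomplex (ih (Q.erase a) (by rw [Finset.card_erase_of_mem haQ]; omega)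
          (hdis.mono_left (Finset.erase_subset _ _))
          (fun v hv => h v (Finset.mem_of_mem_erase hv)) t htS) ?_
        intro x hx
        have hxW := hAW hx
        rw [hW, Finset.mem_union] at hxW
        have hxt : x ≠ t := by rintro rfl; exact ht (Finset.mem_insert_of_mem hx)
        have hxa : x ≠ a := by rintro rfl; exact ha (Finset.mem_insert_of_mem hx)
        simp only [Finset.mem_union, Finset.mem_erase]
        tauto
      · have : (insert t (insert v A)).card = W.card := by rw [htW]
        rw [Finset.card_insert_of_notMem ht, Finset.card_insert_of_notMem (by simpa using hv)] at this
        omega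
    obtain ⟨u, hu, hdu⟩ := leray_fill hcomplex hLeray W (q + 1 + d) (by omega) (dd w) hz (dd_dd w)
    have huQ : ∀ A, u A ≠ 0 → Q ⊆ A := by
      intro A hA a ha
      by_contra haA
      obtain ⟨h1, h2, h3⟩ := hu A hA
      have haW : a ∈ W := by simp [hW, ha]
      have : A = W.erase a := by
        apply Finset.eq_of_subset_of_card_le
        · intro x hx; exact Finset.mem_erase.mpr ⟨fun h => haA (h ▸ hx), h2 hx⟩
        · rw [Finset.card_erase_of_mem haW]; omega
      apply hS
      apply hcomplex h1
      rw [this]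
      intro x hx
      refine Finset.mem_erase.mpr ⟨?_, by simp [hW, hx]⟩
      rintro rfl
      exact Finset.disjoint_left.mp hdis ha hx
    have huw : u - w = 0 := by
      obtain ⟨a, ha⟩ : Q.Nonempty := Finset.card_pos.mp (by omega)
      have h1 := dd_we a (u - w)
      have h2 : dd (u - w) = 0 := by rw [map_sub, hdu, sub_self]
      have h3 : we a (u - w) = 0 := by
        ext A
        rw [we_apply]
        split_ifs with haA
        · have h4 : u (A.erase a) = 0 := by
            by_contra h; have := huQ _ h ha; simp at this
          have h5 : w (A.erase a) = 0 := by
            by_contra h; have := (hwA _ h).1 ha; simp at this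
          simp [h4, h5]
        · rfl
      rw [← h1, h2, h3]; simp
    have hWs : Q ∪ S.erase s = W.erase s := by
      rw [hW, Finset.erase_union_distrib, Finset.erase_eq_of_notMem (s := Q)]
      intro h; exact Finset.disjoint_left.mp hdis h hs
    rw [hWs]
    apply (hu (W.erase s) _).1
    rw [sub_eq_zero.mp huw, hw]
    simp only
    rw [if_pos]
    · exact hDs
    · rw [← hWs]; exact Finset.subset_union_left

lemma sum_swap (G : Finset V → V → ℤ) :
    ∑ σ : Finset V, ∑ v ∈ Finset.univ \ σ, G σ v = ∑ σ : Finset V, ∑ x ∈ σ, G (σ.erase x) x := by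
  rw [Finset.sum_sigma', Finset.sum_sigma']
  refine Finset.sum_bij' (fun p _ => ⟨insert p.2 p.1, p.2⟩) (fun p _ => ⟨p.1.erase p.2, p.2⟩)
    ?_ ?_ ?_ ?_ ?_
  · rintro ⟨σ, v⟩ h; simp
  · rintro ⟨σ, v⟩ h; simp
  · rintro ⟨σ, v⟩ h; simp at h; simp [Finset.erase_insert h]
  · rintro ⟨σ, v⟩ h; simp at h; simp [Finset.insert_erase h]
  · rintro ⟨σ, v⟩ h; simp at h; simp [Finset.erase_insert h]

lemma sg_anti_erase {x y : V} {δ : Finset V} (hx : x ∈ δ) (hy : y ∈ δ) (hxy : x ≠ y) :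
    sg x δ * sg y (δ.erase x) = - (sg y δ * sg x (δ.erase y)) := by
  obtain ⟨β, hxβ, hyβ, rfl⟩ : ∃ β, x ∉ β ∧ y ∉ β ∧ δ = insert x (insert y β) :=
    ⟨(δ.erase x).erase y, by simp, by simp, by
      rw [Finset.insert_erase (Finset.mem_erase.mpr ⟨hxy.symm, hy⟩), Finset.insert_erase hx]⟩
  have h1 : (insert x (insert y β)).erase x = insert y β := Finset.erase_insert (by simp [hxy, hxβ])
  have h2 : (insert x (insert y β)).erase y = insert x β := by
    rw [Finset.insert_comm]; exact Finset.erase_insert (by simp [hxy.symm, hyβ])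
  rw [h1, h2, sg_insert_self, sg_insert_self, sg_insert_self, Finset.insert_comm, sg_insert_self]
  have := sg_anti hxy hxβ hyβ
  linarith

lemma KM {d k : ℕ} (hk1 : 1 ≤ k) (hkd : k ≤ d + 1) (hn : d + 1 ≤ Fintype.card V)
    {K : Finset V → Prop} [DecidablePred K]
    (hcomplex : ∀ ⦃σ τ : Finset V⦄, K τ → σ ⊆ τ → K σ)
    (hLeray : IsDLeray d K)
    {Ind : Finset V → Prop} [DecidablePred Ind] (hM : IsMatroid Ind)
    (hr : k ≤ matRank Ind Finset.univ)
    (hX : ∀ τ, K τ → k ≤ matRank Ind (Finset.univ \ τ)) :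
    ∃ S, ¬ K S ∧ S.card = d + 1 ∧ k ≤ matRank Ind S := by
  by_contra hcon
  have hK : ∀ S : Finset V, S.card = d + 1 → k ≤ matRank Ind S → K S := by
    intro S h1 h2; by_contra h3; exact hcon ⟨S, h3, h1, h2⟩
  set Ind' : Finset V → Prop := fun A => A.card ≤ d + 1 ∧ A.card ≤ matRank Ind A + (d + 1 - k) with hI'
  have hM' : IsMatroid Ind' := elong_isMatroid hM _ _
  have hbase : ∀ W : Finset V, k ≤ matRank Ind W → d + 1 ≤ W.card →
      ∃ B ⊆ W, Ind' B ∧ B.card = d + 1 := by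
    intro W hW hWc
    obtain ⟨I, h1, h2, h3⟩ := exists_of_le_matRank hM hW
    obtain ⟨B, h4, h5, h6⟩ := Finset.exists_subsuperset_card_eq h1 (by omega) hWc
    have := le_matRank h2 h4
    exact ⟨B, h5, ⟨by omega, by omega⟩, h6⟩
  have hIK : ∀ A, Ind' A → K A := by
    intro A hA
    obtain ⟨B, -, hB, hBc⟩ := hbase Finset.univ hr (by simpa using hn)
    obtain ⟨C, h1, -, h3, h4⟩ := mat_extend' hM' hA hB (by have := hA.1; omega)
    refine hcomplex (hK C (by omega) ?_) h1
    have := h3.2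
    omega
  have hK0 : K ∅ := hIK _ hM'.empty
  let Good : ℕ → Finset V → (Finset V → ℤ) → Prop := fun s τ u =>
    ∀ A, u A ≠ 0 → A.card = s ∧ A ⊆ Finset.univ \ τ ∧ K A ∧ (s ≤ d + 1 → Ind' A)
  have fill : ∀ τ s z, ∃ u, K τ → Good s τ z → dd z = 0 → Good (s + 1) τ u ∧ dd u = z := by
    intro τ s z
    by_cases hτ : K τ
    swap
    · exact ⟨0, fun h => absurd h hτ⟩
    by_cases hz : Good s τ z
    swap
    · exact ⟨0, fun _ h => absurd h hz⟩
    by_cases hdz : dd z = 0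
    swap
    · exact ⟨0, fun _ _ h => absurd h hdz⟩
    suffices h : ∃ u, Good (s + 1) τ u ∧ dd u = z by
      obtain ⟨u, hu⟩ := h; exact ⟨u, fun _ _ _ => hu⟩
    have hW := hX τ hτ
    set W := Finset.univ \ τ with hWdef
    by_cases hs : s ≤ d
    · by_cases hWc : d + 1 ≤ W.card
      · obtain ⟨B, h1, h2, h3⟩ := hbase W hW hWc
        obtain ⟨u, hu, hdu⟩ := mat_fill _ Ind' hM' W rfl s B h1 h2 (by omega) z (by
          intro A hA
          obtain ⟨g1, g2, g3, g4⟩ := hz A hA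
          exact ⟨g4 (by omega), g2, g1⟩) hdz
        refine ⟨u, ?_, hdu⟩
        intro A hA
        obtain ⟨g1, g2, g3⟩ := hu A hA
        exact ⟨g3, g2, hIK A g1, fun _ => g1⟩
      · have hWI : Ind' W := ⟨by omega, by omega⟩
        obtain ⟨I, hIW, -, hIc⟩ := exists_of_le_matRank hM hW
        obtain ⟨e, he⟩ : I.Nonempty := Finset.card_pos.mp (by omega)
        have heW := hIW he
        refine ⟨we e z, ?_, ?_⟩
        · intro A hA
          rw [we_apply] at hA
          by_cases heA : e ∈ A
          · rw [if_pos heA] at hA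
            obtain ⟨g1, g2, g3, g4⟩ := hz _ (right_ne_zero_of_mul hA)
            rw [Finset.card_erase_of_mem heA] at g1
            have := Finset.card_pos.mpr ⟨e, heA⟩
            have hAW : A ⊆ W := by
              rw [← Finset.insert_erase heA]; exact Finset.insert_subset heW g2
            have := hM'.subset hWI hAW
            exact ⟨by omega, hAW, hIK _ this, fun _ => this⟩
          · simp [heA] at hA
        · have := dd_we e z
          rw [hdz, map_zero, add_zero] at this; exact this
    · obtain ⟨u, hu, hdu⟩ := leray_fill hcomplex hLeray W s (by omega) z (by
          intro A hA
          obtain ⟨g1, g2, g3, g4⟩ := hz A hA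
          exact ⟨g3, g2, g1⟩) hdz
      refine ⟨u, ?_, hdu⟩
      intro A hA
      obtain ⟨g1, g2, g3⟩ := hu A hA
      exact ⟨g3, g2, g1, fun _ => by omega⟩
  choose F hF using fill
  obtain ⟨Φ, hΦ0, hΦs⟩ : ∃ Φ : ℕ → Finset V → Finset V → (Finset V → ℤ),
      (∀ τ δ, Φ 0 τ δ = F τ 0 (Pi.single ∅ 1)) ∧
      (∀ j τ δ, Φ (j+1) τ δ = F τ (j+1)
        (∑ x ∈ δ, sg x δ • (Φ j (insert x τ) (δ.erase x) - Φ j τ (δ.erase x)))) :=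
    ⟨fun j => Nat.rec (fun τ _ => F τ 0 (Pi.single ∅ 1)) (fun j Φj τ δ => F τ (j+1)
        (∑ x ∈ δ, sg x δ • (Φj (insert x τ) (δ.erase x) - Φj τ (δ.erase x)))) j,
      fun _ _ => rfl, fun _ _ _ => rfl⟩
  have main0 : ∀ τ δ, K τ → Good 1 τ (Φ 0 τ δ) ∧ dd (Φ 0 τ δ) = Pi.single ∅ 1 := by
    intro τ δ hτ
    rw [hΦ0]
    apply hF τ 0 _ hτ
    · intro A hA
      have : A = ∅ := by by_contra h; simp [h] at hA
      subst this
      exact ⟨rfl, by simp, hK0, fun _ => hM'.empty⟩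
    · rw [dd_single]; simp
  have main : ∀ j τ δ, Disjoint τ δ → K (τ ∪ δ) → δ.card = j + 1 →
      Good (j + 2) τ (Φ (j+1) τ δ) ∧ dd (Φ (j+1) τ δ) =
        ∑ x ∈ δ, sg x δ • (Φ j (insert x τ) (δ.erase x) - Φ j τ (δ.erase x)) := by
    intro j
    -- the right-hand side is good as soon as the lower pieces are
    have goodRHS : ∀ j τ δ, (∀ x ∈ δ, Good (j+1) (insert x τ) (Φ j (insert x τ) (δ.erase x)) ∧
        Good (j+1) τ (Φ j τ (δ.erase x))) →
        Good (j+1) τ (∑ x ∈ δ, sg x δ • (Φ j (insert x τ) (δ.erase x) - Φ j τ (δ.erase x))) := by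
      intro j τ δ h A hA
      rw [Finset.sum_apply] at hA
      obtain ⟨x, hx, h1⟩ := Finset.exists_ne_zero_of_sum_ne_zero hA
      obtain ⟨g1, g2⟩ := h x hx
      by_cases h2 : Φ j τ (δ.erase x) A = 0
      · have h3 : Φ j (insert x τ) (δ.erase x) A ≠ 0 := by
          intro h3; apply h1; simp [h2, h3]
        obtain ⟨f1, f2, f3, f4⟩ := g1 A h3
        exact ⟨f1, f2.trans (Finset.sdiff_subset_sdiff le_rfl (Finset.subset_insert _ _)), f3, f4⟩
      · exact g2 A h2
    have side : ∀ (τ δ : Finset V) (x), Disjoint τ δ → K (τ ∪ δ) → x ∈ δ →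
        Disjoint (insert x τ) (δ.erase x) ∧ K (insert x τ ∪ δ.erase x) ∧
        Disjoint τ (δ.erase x) ∧ K (τ ∪ δ.erase x) ∧ K (insert x τ) ∧ K τ := by
      intro τ δ x hdis hKτ hx
      have hd2 : Disjoint τ (δ.erase x) := hdis.mono_right (Finset.erase_subset _ _)
      refine ⟨?_, hcomplex hKτ ?_, hd2, hcomplex hKτ ?_, hcomplex hKτ ?_, hcomplex hKτ ?_⟩
      · rw [Finset.disjoint_insert_left]; exact ⟨by simp, hd2⟩
      · intro y; simp only [Finset.mem_union, Finset.mem_insert, Finset.mem_erase]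
        rintro ((rfl | h) | h)
        · exact Or.inr hx
        · exact Or.inl h
        · exact Or.inr h.2
      · exact Finset.union_subset_union le_rfl (Finset.erase_subset _ _)
      · intro y; simp only [Finset.mem_union, Finset.mem_insert]
        rintro (rfl | h)
        · exact Or.inr hx
        · exact Or.inl h
      · exact Finset.subset_union_left
    induction j with
    | zero =>
      intro τ δ hdis hKτ hδ
      rw [hΦs]
      apply hF τ 1 _ (hcomplex hKτ Finset.subset_union_left)
      · apply goodRHS 0
        intro x hx
        obtain ⟨-, -, -, -, s1, s2⟩ := side τ δ x hdis hKτ hx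
        exact ⟨(main0 _ _ s1).1, (main0 _ _ s2).1⟩
      · rw [map_sum]
        apply Finset.sum_eq_zero
        intro x hx
        obtain ⟨-, -, -, -, s1, s2⟩ := side τ δ x hdis hKτ hx
        rw [map_smul, map_sub, (main0 _ _ s1).2, (main0 _ _ s2).2]; simp
    | succ j ih =>
      intro τ δ hdis hKτ hδ
      rw [hΦs]
      apply hF τ (j+1+1) _ (hcomplex hKτ Finset.subset_union_left)
      · apply goodRHS (j+1)
        intro x hx
        obtain ⟨s1, s2, s3, s4, -, -⟩ := side τ δ x hdis hKτ hx
        have hc : (δ.erase x).card = j + 1 := by rw [Finset.card_erase_of_mem hx]; omega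
        exact ⟨(ih _ _ s1 s2 hc).1, (ih _ _ s3 s4 hc).1⟩
      · let f : V → V → (Finset V → ℤ) := fun x y => (sg x δ * sg y (δ.erase x)) •
          ((Φ j (insert y (insert x τ)) ((δ.erase x).erase y) - Φ j (insert x τ) ((δ.erase x).erase y))
          - (Φ j (insert y τ) ((δ.erase x).erase y) - Φ j τ ((δ.erase x).erase y)))
        have e1 : dd (∑ x ∈ δ, sg x δ • (Φ (j+1) (insert x τ) (δ.erase x) - Φ (j+1) τ (δ.erase x)))
            = ∑ x ∈ δ, ∑ y ∈ δ.erase x, f x y := by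
          rw [map_sum]
          apply Finset.sum_congr rfl
          intro x hx
          obtain ⟨s1, s2, s3, s4, -, -⟩ := side τ δ x hdis hKτ hx
          have hc : (δ.erase x).card = j + 1 := by rw [Finset.card_erase_of_mem hx]; omega
          rw [map_smul, map_sub, (ih _ _ s1 s2 hc).2, (ih _ _ s3 s4 hc).2,
            ← Finset.sum_sub_distrib, Finset.smul_sum]
          apply Finset.sum_congr rfl
          intro y _
          simp only [f]
          rw [← smul_sub, smul_smul]
        have e2 : ∑ x ∈ δ, ∑ y ∈ δ.erase x, f x y = ∑ y ∈ δ, ∑ x ∈ δ.erase y, f x y := by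
          apply Finset.sum_comm'
          intro x y
          simp only [Finset.mem_erase]
          constructor
          · rintro ⟨h1, h2, h3⟩; exact ⟨⟨Ne.symm h2, h1⟩, h3⟩
          · rintro ⟨⟨h1, h2⟩, h3⟩; exact ⟨h2, Ne.symm h1, h3⟩
        have e3 : ∑ y ∈ δ, ∑ x ∈ δ.erase y, f x y = - ∑ x ∈ δ, ∑ y ∈ δ.erase x, f x y := by
          rw [← Finset.sum_neg_distrib]
          apply Finset.sum_congr rfl
          intro y hy
          rw [← Finset.sum_neg_distrib]
          apply Finset.sum_congr rfl
          intro x hx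
          obtain ⟨hxy, hx⟩ := Finset.mem_erase.mp hx
          simp only [f]
          rw [sg_anti_erase hx hy hxy, Finset.erase_right_comm, Finset.insert_comm, neg_smul]
          congr 2
          abel
        rw [e1]
        rw [e3] at e2
        ext A
        have := congrFun e2 A
        simp only [Pi.neg_apply, Pi.zero_apply] at this ⊢
        omega
  -- trace argument
  set H : Finset V → Finset V → ℤ := fun σ => Φ σ.card ∅ σ with hH
  have hHgood : ∀ σ, K σ → ∀ A, H σ A ≠ 0 → K A := by
    intro σ hσ A hA
    rcases Nat.eq_zero_or_pos σ.card with h0 | h0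
    · simp only [hH, h0] at hA
      exact ((main0 ∅ σ hK0).1 A hA).2.2.1
    · obtain ⟨j, hj⟩ : ∃ j, σ.card = j + 1 := ⟨σ.card - 1, by omega⟩
      simp only [hH, hj] at hA
      exact ((main j ∅ σ (by simp) (by simpa using hσ) hj).1 A hA).2.2.1
  have hHdd : ∀ σ, K σ → dd (H σ) σ = (if σ = ∅ then 1 else 0) - ∑ x ∈ σ, sg x σ * H (σ.erase x) σ := by
    intro σ hσ
    by_cases h0 : σ = ∅
    · subst h0
      have := (main0 ∅ ∅ hK0).2
      simp only [hH, Finset.card_empty, this]; simp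
    · have := Finset.card_pos.mpr (Finset.nonempty_iff_ne_empty.mpr h0)
      obtain ⟨j, hj⟩ : ∃ j, σ.card = j + 1 := ⟨σ.card - 1, by omega⟩
      have h1 := (main j ∅ σ (by simp) (by simpa using hσ) hj).2
      simp only [hH, hj, h1, if_neg h0, Finset.sum_apply, zero_sub, ← Finset.sum_neg_distrib]
      apply Finset.sum_congr rfl
      intro x hx
      have hc : (σ.erase x).card = j := by rw [Finset.card_erase_of_mem hx]; omega
      have hz : Φ j (insert x ∅) (σ.erase x) σ = 0 := by
        by_contra hne
        have hg : Good (j+1) (insert x ∅) (Φ j (insert x ∅) (σ.erase x)) := by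
          rcases j with _ | j
          · exact (main0 _ _ (hcomplex hσ (by simpa using hx))).1
          · refine (main j _ _ (by simp) ?_ hc).1
            rw [Finset.insert_union, Finset.empty_union, Finset.insert_erase hx]; exact hσ
        have := (hg σ hne).2.1 hx
        simp at this
      simp only [insert_empty_eq] at hz
      simp [hc, hz]
  let g : Finset V → V → ℤ := fun σ v =>
    if K (insert v σ) then (-1) ^ σ.card * (sg v σ * H σ (insert v σ)) else 0
  have t1 : ∑ σ : Finset V, (if K σ then (-1) ^ σ.card * dd (H σ) σ else 0)
      = ∑ σ : Finset V, ∑ v ∈ Finset.univ \ σ, g σ v := by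
    apply Finset.sum_congr rfl
    intro σ _
    by_cases hσ : K σ
    · rw [if_pos hσ, dd_apply, Finset.mul_sum]
      apply Finset.sum_congr rfl
      intro v _
      simp only [g]
      split_ifs with h
      · rfl
      · have : H σ (insert v σ) = 0 := by by_contra h2; exact h (hHgood σ hσ _ h2)
        simp [this]
    · rw [if_neg hσ, Finset.sum_eq_zero]
      intro v _
      simp only [g]
      rw [if_neg]
      intro h; exact hσ (hcomplex h (Finset.subset_insert _ _))
  have t2 : ∑ σ : Finset V, (if K σ then (-1) ^ σ.card * dd (H σ) σ else 0)
      = 1 + ∑ σ : Finset V, ∑ x ∈ σ, g (σ.erase x) x := by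
    have : (1 : ℤ) = ∑ σ : Finset V, (if σ = ∅ then 1 else 0) := by simp
    rw [this, ← Finset.sum_add_distrib]
    apply Finset.sum_congr rfl
    intro σ _
    by_cases hσ : K σ
    · rw [if_pos hσ, hHdd σ hσ]
      have : ∑ x ∈ σ, g (σ.erase x) x = - ((-1) ^ σ.card * ∑ x ∈ σ, sg x σ * H (σ.erase x) σ) := by
        rw [Finset.mul_sum, ← Finset.sum_neg_distrib]
        apply Finset.sum_congr rfl
        intro x hx
        simp only [g]
        have hp : (-1 : ℤ) ^ σ.card = - (-1) ^ (σ.erase x).card := by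
          rw [← Finset.card_erase_add_one hx, pow_succ]; ring
        rw [Finset.insert_erase hx, if_pos hσ, sg_erase_self, hp]; ring
      rw [this]
      by_cases h0 : σ = ∅
      · subst h0; simp
      · simp [h0]
    · have h0 : σ ≠ ∅ := by rintro rfl; exact hσ hK0
      rw [if_neg hσ, if_neg h0, Finset.sum_eq_zero]; · simp
      intro x hx
      simp only [g]
      rw [Finset.insert_erase hx, if_neg hσ]
  rw [t1, sum_swap] at t2
  omega

end Main

/-- Colorful Helly for `d`-Leray complexes and matroids
(Theorem: very colorful Helly, `d`-Leray version). -/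
theorem stmt_10 {V : Type*} [DecidableEq V] [LinearOrder V] [Fintype V]
    (d r m k : ℕ) (hd : 1 ≤ d) (hr : d + 1 ≤ r) (hm1 : 1 ≤ m) (hmr : m ≤ r)
    (hmk : m ≤ k) (hk : k ≤ min (m + d) r)
    (hV : max (m + d) r ≤ Fintype.card V)
    (K : Finset V → Prop) [DecidablePred K]
    (hcomplex : ∀ ⦃σ τ : Finset V⦄, K τ → σ ⊆ τ → K σ)
    (hLeray : IsDLeray d K)
    (Ind : Finset V → Prop) [DecidablePred Ind] (hM : IsMatroid Ind)
    (hrank : matRank Ind Finset.univ = r)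
    (hyp : ∀ S T : Finset V, Disjoint S T → S.card = d + 1 → T.card = m - 1 →
      k ≤ matRank Ind (S ∪ T) →
      K S ∨ ∃ v ∈ T, ∀ σ : Finset V, σ ⊂ S → K (insert v σ)) :
    ∃ τ : Finset V, K τ ∧ matRank Ind (Finset.univ \ τ) ≤ k - 1 := by
  by_contra hcon
  have hX : ∀ τ, K τ → k ≤ matRank Ind (Finset.univ \ τ) := by
    intro τ hτ
    by_contra h
    exact hcon ⟨τ, hτ, by omega⟩
  have hk1 : k ≤ m + d := hk.trans (min_le_left _ _)
  have hk2 : k ≤ r := hk.trans (min_le_right _ _)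
  have hV1 : m + d ≤ Fintype.card V := (le_max_left _ _).trans hV
  obtain ⟨S, hS, hSc, hSr⟩ := KM (d := d) (k := k - m + 1) (by omega) (by omega) (by omega)
    hcomplex hLeray hM (by omega) (fun τ hτ => by have := hX τ hτ; omega)
  -- the exchangeable vertices
  set G : Finset V := (Finset.univ \ S).filter (fun v => ∃ s ∈ S, ¬ K (insert v (S.erase s))) with hG
  have hGS : Disjoint S G := by
    rw [Finset.disjoint_left]; intro x hx hxG; simp [hG, hx] at hxG
  have hGk : k ≤ matRank Ind (S ∪ G) ∧ m - 1 ≤ G.card := by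
    set Q : Finset V := Finset.univ \ (S ∪ G) with hQ
    rcases Nat.eq_zero_or_pos Q.card with h0 | h0
    · have hu : S ∪ G = Finset.univ := by
        rw [Finset.card_eq_zero, hQ, Finset.sdiff_eq_empty_iff_subset] at h0
        exact Finset.univ_subset_iff.mp h0
      refine ⟨by rw [hu, hrank]; exact hk2, ?_⟩
      have h1 : (S ∪ G).card = Fintype.card V := by rw [hu]; rfl
      rw [Finset.card_union_of_disjoint hGS] at h1
      omega
    · obtain ⟨s, hs⟩ : S.Nonempty := Finset.card_pos.mp (by omega)
      have hc := conn hcomplex hLeray hS hSc (Q.card - 1) Q (by omega) (by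
        rw [Finset.disjoint_left]; intro x hx hxS; simp [hQ, hxS] at hx) (by
        intro v hv t ht
        by_contra hne
        simp only [hQ, Finset.mem_sdiff, Finset.mem_univ, true_and, Finset.mem_union, not_or] at hv
        apply hv.2
        simp only [hG, Finset.mem_filter, Finset.mem_sdiff, Finset.mem_univ, true_and]
        exact ⟨hv.1, t, ht, hne⟩) s hs
      have h1 := hX _ hc
      have hsub : Finset.univ \ (Q ∪ S.erase s) ⊆ insert s G := by
        intro x hx
        simp only [hQ, Finset.mem_sdiff, Finset.mem_univ, true_and, Finset.mem_union, not_or,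
          Finset.mem_erase, not_and] at hx
        rw [Finset.mem_insert]
        by_contra hne
        simp only [not_or] at hne
        exact hx.1 (fun hxS => hx.2 hne.1 hxS) hne.2
      have h2 := h1.trans (matRank_mono hM hsub)
      refine ⟨h2.trans (matRank_mono hM ?_), ?_⟩
      · intro x hx
        rcases Finset.mem_insert.mp hx with rfl | h
        · exact Finset.mem_union_left _ hs
        · exact Finset.mem_union_right _ h
      · obtain ⟨I, hI, -, hIc⟩ := exists_of_le_matRank hM h2
        have := Finset.card_le_card hI
        have := Finset.card_insert_le s G
        omega
  obtain ⟨I, hIS, hI, hIc⟩ := exists_of_le_matRank hM hSr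
  obtain ⟨J, hJS, hJ, hJc⟩ := exists_of_le_matRank hM hGk.1
  obtain ⟨C, hIC, hCIJ, hC, hCc⟩ := mat_extend' hM hI hJ (by omega)
  have hCS : C ⊆ S ∪ G := hCIJ.trans (Finset.union_subset (hIS.trans Finset.subset_union_left) hJS)
  have hT0 : (C \ S).card ≤ m - 1 := by
    have h1 : (C \ S).card ≤ (C \ I).card :=
      Finset.card_le_card (Finset.sdiff_subset_sdiff le_rfl hIS)
    have h2 := Finset.card_sdiff_add_card_eq_card hIC
    omega
  have hT1 : C \ S ⊆ G := by
    intro x hx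
    rw [Finset.mem_sdiff] at hx
    exact (Finset.mem_union.mp (hCS hx.1)).resolve_left hx.2
  obtain ⟨T, hT2, hTG, hTc⟩ := Finset.exists_subsuperset_card_eq hT1 hT0 hGk.2
  have hCT : C ⊆ S ∪ T := by
    intro x hx
    by_cases hxS : x ∈ S
    · exact Finset.mem_union_left _ hxS
    · exact Finset.mem_union_right _ (hT2 (Finset.mem_sdiff.mpr ⟨hx, hxS⟩))
  have hrk : k ≤ matRank Ind (S ∪ T) := by
    have := le_matRank hC hCT; omega
  rcases hyp S T (hGS.mono_right hTG) hSc hTc hrk with h | ⟨v, hv, h⟩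
  · exact hS h
  · have hvG := hTG hv
    simp only [hG, Finset.mem_filter] at hvG
    obtain ⟨-, s, hs, hne⟩ := hvG
    exact hne (h _ (Finset.erase_ssubset hs))
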